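/- In the proof of the moment-product comparison lemma: let X, Z ∈ ℝ^d be random vectors with E[|X_i|^{q+d}] < C_q and E[|Z_i|^{q+d}] < C_q for all i and some q > 0. Then for every truncation level T > 0, |E[∏_{i=1}^d X_i] − E[∏_{i=1}^d Z_i]| ≤ √d · T^{d−1} · d_1(X,Z) + T^{−q} · 4d · C_q. -/

import Mathlib

open MeasureTheory ProbabilityTheory Finset

noncomputable section

/-- `ζ` is `1`-Lipschitz with respect to the Euclidean norm on `ι → ℝ`. -/
def LipschitzEuclid {ι : Type*} [Fintype ι] (ζ : (ι → ℝ) → ℝ) : Prop :=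
  ∀ f g : ι → ℝ, |ζ f - ζ g| ≤ Real.sqrt (∑ i, (f i - g i) ^ 2)

/-- The Wasserstein-1 distance between the laws of `X` and `Y`, as a supremum over
`1`-Lipschitz (w.r.t. the Euclidean norm) test functions. -/
def d1 {Ω : Type*} [MeasurableSpace Ω] {ι : Type*} [Fintype ι]
    (μ : Measure Ω) (X Y : Ω → ι → ℝ) : ℝ :=
  sSup {r | ∃ ζ : (ι → ℝ) → ℝ, LipschitzEuclid ζ ∧
    r = |(∫ ω, ζ (X ω) ∂μ) - ∫ ω, ζ (Y ω) ∂μ|}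

/-- First partial derivative of `η` at `x` in coordinate `i`. -/
def pd1 {ι : Type*} [Fintype ι] [DecidableEq ι] (η : (ι → ℝ) → ℝ) (x : ι → ℝ) (i : ι) : ℝ :=
  iteratedFDeriv ℝ 1 η x fun _ => Pi.single i 1

/-- Second partial derivative of `η` at `x` in coordinates `i, j`. -/
def pd2 {ι : Type*} [Fintype ι] [DecidableEq ι] (η : (ι → ℝ) → ℝ) (x : ι → ℝ) (i j : ι) : ℝ :=
  iteratedFDeriv ℝ 2 η x ![Pi.single i 1, Pi.single j 1]

/-- Third partial derivative of `η` at `x` in coordinates `i, j, k`. -/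
def pd3 {ι : Type*} [Fintype ι] [DecidableEq ι] (η : (ι → ℝ) → ℝ) (x : ι → ℝ) (i j k : ι) : ℝ :=
  iteratedFDeriv ℝ 3 η x ![Pi.single i 1, Pi.single j 1, Pi.single k 1]

/-- Test functions for the `d₃` metric: three times differentiable with all first, second and
third partial derivatives bounded by one. -/
def TestD3 {ι : Type*} [Fintype ι] [DecidableEq ι] (ζ : (ι → ℝ) → ℝ) : Prop :=
  ContDiff ℝ 3 ζ ∧ (∀ x i, |pd1 ζ x i| ≤ 1) ∧ (∀ x i j, |pd2 ζ x i j| ≤ 1) ∧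
    (∀ x i j k, |pd3 ζ x i j k| ≤ 1)

/-- The `d₃` integral probability metric between the laws of `X` and `Y`. -/
def d3 {Ω : Type*} [MeasurableSpace Ω] {ι : Type*} [Fintype ι] [DecidableEq ι]
    (μ : Measure Ω) (X Y : Ω → ι → ℝ) : ℝ :=
  sSup {r | ∃ ζ : (ι → ℝ) → ℝ, TestD3 ζ ∧
    r = |(∫ ω, ζ (X ω) ∂μ) - ∫ ω, ζ (Y ω) ∂μ|}

theorem abs_prod_le_pow_card {ι : Type*} (s : Finset ι) (a : ι → ℝ) {T : ℝ}
    (ha : ∀ i, |a i| ≤ T) : |∏ i ∈ s, a i| ≤ T ^ #s := by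
  rw [abs_prod, ← prod_const]
  exact prod_le_prod (fun _ _ => abs_nonneg _) fun i _ => ha i

theorem mul_abs_prod_sub_prod_le {ι : Type*} (s : Finset ι) (a b : ι → ℝ) {T : ℝ}
    (hT : 0 ≤ T) (ha : ∀ i, |a i| ≤ T) (hb : ∀ i, |b i| ≤ T) :
    T * |∏ i ∈ s, a i - ∏ i ∈ s, b i| ≤ T ^ #s * ∑ i ∈ s, |a i - b i| := by
  classical
  induction s using Finset.induction_on with
  | empty => simp
  | insert j s hj ih =>
    rw [prod_insert hj, prod_insert hj, sum_insert hj, card_insert_of_notMem hj]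
    have hprod : |∏ i ∈ s, a i| ≤ T ^ #s := abs_prod_le_pow_card s a ha
    have hsplit : a j * ∏ i ∈ s, a i - b j * ∏ i ∈ s, b i =
        (a j - b j) * ∏ i ∈ s, a i + b j * (∏ i ∈ s, a i - ∏ i ∈ s, b i) := by ring
    calc T * |a j * ∏ i ∈ s, a i - b j * ∏ i ∈ s, b i|
        ≤ T * (|a j - b j| * |∏ i ∈ s, a i| + |b j| * |∏ i ∈ s, a i - ∏ i ∈ s, b i|) := by
          rw [hsplit, ← abs_mul, ← abs_mul]
          gcongr
          exact abs_add_le _ _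
      _ = T * (|a j - b j| * |∏ i ∈ s, a i|) +
            |b j| * (T * |∏ i ∈ s, a i - ∏ i ∈ s, b i|) := by ring
      _ ≤ T * (|a j - b j| * T ^ #s) + T * (T ^ #s * ∑ i ∈ s, |a i - b i|) := by
          gcongr
          exact hb j
      _ = T ^ (#s + 1) * (|a j - b j| + ∑ i ∈ s, |a i - b i|) := by ring

theorem sum_abs_le_sqrt_card_mul_sqrt {ι : Type*} [Fintype ι] (v : ι → ℝ) :
    ∑ i, |v i| ≤ Real.sqrt (Fintype.card ι) * Real.sqrt (∑ i, v i ^ 2) := by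
  rw [← Real.sqrt_mul (Nat.cast_nonneg _)]
  refine Real.le_sqrt_of_sq_le ?_
  simpa using sq_sum_le_card_mul_sum_sq (s := Finset.univ) (f := fun i => |v i|)

/-- Truncation of a real number to the interval `[-T, T]`. -/
def clip (T x : ℝ) : ℝ := max (-T) (min T x)

theorem abs_clip_le {T : ℝ} (hT : 0 ≤ T) (x : ℝ) : |clip T x| ≤ T :=
  abs_le.2 ⟨le_max_left _ _, max_le (by linarith) (min_le_left _ _)⟩

theorem abs_clip_le_abs {T : ℝ} (hT : 0 ≤ T) (x : ℝ) : |clip T x| ≤ |x| := by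
  refine abs_le.2 ⟨?_, max_le (by linarith [abs_nonneg x])
    ((min_le_right _ _).trans (le_abs_self x))⟩
  exact le_max_of_le_right (le_min (by linarith [abs_nonneg x]) (neg_abs_le x))

theorem abs_clip_sub_clip_le (T x y : ℝ) : |clip T x - clip T y| ≤ |x - y| := by
  unfold clip
  refine (abs_max_sub_max_le_max _ _ _ _).trans ?_
  simp only [sub_self, abs_zero]
  refine max_le (abs_nonneg _) ((abs_min_sub_min_le_max _ _ _ _).trans ?_)
  simp

theorem clip_eq_self {T x : ℝ} (h : |x| ≤ T) : clip T x = x := by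
  rw [clip, min_eq_right (abs_le.1 h).2, max_eq_right (abs_le.1 h).1]

theorem measurable_clip (T : ℝ) : Measurable (clip T) := by
  unfold clip
  fun_prop

theorem abs_prod_clip_sub_prod_clip_le {d : ℕ} {T : ℝ} (hT : 0 < T) (x y : Fin d → ℝ) :
    |∏ i, clip T (x i) - ∏ i, clip T (y i)| ≤
      Real.sqrt d * T ^ ((d : ℝ) - 1) * Real.sqrt (∑ i, (x i - y i) ^ 2) := by
  have h := mul_abs_prod_sub_prod_le Finset.univ (fun i => clip T (x i)) (fun i => clip T (y i))
    hT.le (fun i => abs_clip_le hT.le _) (fun i => abs_clip_le hT.le _)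
  have hsum : ∑ i, |clip T (x i) - clip T (y i)| ≤
      Real.sqrt d * Real.sqrt (∑ i, (x i - y i) ^ 2) :=
    (sum_le_sum fun i _ => abs_clip_sub_clip_le T (x i) (y i)).trans
      (by simpa using sum_abs_le_sqrt_card_mul_sqrt fun i => x i - y i)
  have hpow : T ^ d = T * T ^ ((d : ℝ) - 1) := by
    rw [Real.rpow_sub_one hT.ne', Real.rpow_natCast]
    field_simp
  rw [card_univ, Fintype.card_fin, hpow, mul_assoc] at h
  calc _ ≤ T ^ ((d : ℝ) - 1) * ∑ i, |clip T (x i) - clip T (y i)| := le_of_mul_le_mul_left h hT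
    _ ≤ T ^ ((d : ℝ) - 1) * (Real.sqrt d * Real.sqrt (∑ i, (x i - y i) ^ 2)) := by gcongr
    _ = _ := by ring

theorem abs_prod_le_of_exists_lt {d : ℕ} {q T : ℝ} (hq : 0 ≤ q) (hT : 0 < T) (x : Fin d → ℝ)
    (hx : ∃ i, T < |x i|) : |∏ i, x i| ≤ T ^ (-q) * ∑ i, |x i| ^ (q + d) := by
  obtain ⟨i₀, hi₀⟩ := hx
  obtain ⟨i, -, hi⟩ := exists_max_image Finset.univ (fun i => |x i|) ⟨i₀, mem_univ _⟩
  have hTi : T < |x i| := hi₀.trans_le (hi i₀ (mem_univ _))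
  have hpos : 0 < |x i| := hT.trans hTi
  calc |∏ j, x j| ≤ |x i| ^ d := by
        simpa using abs_prod_le_pow_card Finset.univ x fun j => hi j (mem_univ j)
    _ = |x i| ^ (-q) * |x i| ^ (q + d) := by
        rw [← Real.rpow_add hpos, neg_add_cancel_left, Real.rpow_natCast]
    _ ≤ T ^ (-q) * |x i| ^ (q + d) := by
        gcongr ?_ * _
        exact Real.rpow_le_rpow_of_nonpos hT hTi.le (by linarith)
    _ ≤ T ^ (-q) * ∑ j, |x j| ^ (q + d) := by
        gcongr
        exact single_le_sum (f := fun j => |x j| ^ (q + d)) (fun j _ => by positivity) (mem_univ i)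

theorem abs_prod_clip_le {d : ℕ} {T : ℝ} (hT : 0 ≤ T) (x : Fin d → ℝ) :
    |∏ i, clip T (x i)| ≤ T ^ d := by
  simpa using abs_prod_le_pow_card Finset.univ (fun i => clip T (x i)) fun i => abs_clip_le hT _

theorem abs_prod_sub_prod_clip_le {d : ℕ} {q T : ℝ} (hq : 0 ≤ q) (hT : 0 < T) (x : Fin d → ℝ) :
    |∏ i, x i - ∏ i, clip T (x i)| ≤ 2 * (T ^ (-q) * ∑ i, |x i| ^ (q + d)) := by
  by_cases hx : ∃ i, T < |x i|
  · have h1 := abs_prod_le_of_exists_lt hq hT x hx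
    have h2 : |∏ i, clip T (x i)| ≤ |∏ i, x i| := by
      rw [abs_prod, abs_prod]
      exact prod_le_prod (fun _ _ => abs_nonneg _) fun i _ => abs_clip_le_abs hT.le _
    have h3 := abs_sub (∏ i, x i) (∏ i, clip T (x i))
    linarith
  · push Not at hx
    simp only [fun i => clip_eq_self (hx i), sub_self, abs_zero]
    positivity

section Moments

variable {Ω : Type*} [MeasurableSpace Ω] {μ : Measure Ω} [IsProbabilityMeasure μ] {d : ℕ}
  {X Z : Ω → Fin d → ℝ}

theorem integrable_prod_clip (hX : Measurable X) {T : ℝ} (hT : 0 ≤ T) :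
    Integrable (fun ω => ∏ i, clip T (X ω i)) μ := by
  refine Integrable.of_bound (C := T ^ d) (Measurable.aestronglyMeasurable ?_)
    (ae_of_all _ fun ω => abs_prod_clip_le hT (X ω))
  exact Finset.measurable_fun_prod _ fun i _ => (measurable_clip T).comp (measurable_pi_iff.1 hX i)

theorem integrable_prod_of_moments {q : ℝ} (hq : 0 ≤ q) (hX : Measurable X)
    (hXi : ∀ i, Integrable (fun ω => |X ω i| ^ (q + d)) μ) :
    Integrable (fun ω => ∏ i, X ω i) μ := by
  have hdiff : Integrable (fun ω => ∏ i, X ω i - ∏ i, clip 1 (X ω i)) μ := by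
    refine (((integrable_finsetSum _ fun i _ => hXi i).const_mul
      ((1 : ℝ) ^ (-q))).const_mul 2).mono' ?_
      (ae_of_all _ fun ω => abs_prod_sub_prod_clip_le hq one_pos (X ω))
    refine AEStronglyMeasurable.sub (Measurable.aestronglyMeasurable ?_)
      (integrable_prod_clip hX zero_le_one).aestronglyMeasurable
    exact Finset.measurable_fun_prod _ fun i _ => measurable_pi_iff.1 hX i
  refine (hdiff.add (integrable_prod_clip hX zero_le_one)).congr (ae_of_all _ fun ω => ?_)
  simp

theorem abs_integral_prod_sub_integral_prod_clip_le {q C T : ℝ} (hq : 0 ≤ q) (hT : 0 < T)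
    (hX : Measurable X) (hXi : ∀ i, Integrable (fun ω => |X ω i| ^ (q + d)) μ)
    (hXm : ∀ i, ∫ ω, |X ω i| ^ (q + d) ∂μ ≤ C) :
    |∫ ω, ∏ i, X ω i ∂μ - ∫ ω, ∏ i, clip T (X ω i) ∂μ| ≤ T ^ (-q) * (2 * d * C) := by
  rw [← integral_sub (integrable_prod_of_moments hq hX hXi) (integrable_prod_clip hX hT.le)]
  calc |∫ ω, (∏ i, X ω i - ∏ i, clip T (X ω i)) ∂μ|
      ≤ ∫ ω, 2 * (T ^ (-q) * ∑ i, |X ω i| ^ (q + d)) ∂μ := by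
        rw [← Real.norm_eq_abs]
        exact norm_integral_le_of_norm_le
          (((integrable_finsetSum _ fun i _ => hXi i).const_mul _).const_mul _)
          (ae_of_all _ fun ω => abs_prod_sub_prod_clip_le hq hT (X ω))
    _ = 2 * (T ^ (-q) * ∑ i, ∫ ω, |X ω i| ^ (q + d) ∂μ) := by
        rw [integral_const_mul, integral_const_mul, integral_finsetSum _ fun i _ => hXi i]
    _ ≤ 2 * (T ^ (-q) * ∑ _i : Fin d, C) := by
        gcongr with i
        exact hXm i
    _ = T ^ (-q) * (2 * d * C) := by
        rw [sum_const, card_univ, Fintype.card_fin, nsmul_eq_mul]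
        ring

theorem integrable_coord_of_moments {q : ℝ} (hq : 0 ≤ q) (hX : Measurable X)
    (hXi : ∀ i, Integrable (fun ω => |X ω i| ^ (q + d)) μ) (i : Fin d) :
    Integrable (fun ω => X ω i) μ := by
  refine ((integrable_const (1 : ℝ)).add (hXi i)).mono'
    (measurable_pi_iff.1 hX i).aestronglyMeasurable (ae_of_all _ fun ω => ?_)
  have hd : (1 : ℝ) ≤ d := by exact_mod_cast i.pos
  simp only [Pi.add_apply, Real.norm_eq_abs]
  rcases le_total |X ω i| 1 with h | h
  · have : 0 ≤ |X ω i| ^ (q + d) := by positivity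
    linarith
  · have := Real.self_le_rpow_of_one_le h (show 1 ≤ q + d by linarith)
    linarith

end Moments

theorem LipschitzEuclid.abs_sub_le_sum {ι : Type*} [Fintype ι] {ζ : (ι → ℝ) → ℝ}
    (hζ : LipschitzEuclid ζ) (x y : ι → ℝ) : |ζ x - ζ y| ≤ ∑ i, |x i - y i| := by
  refine (hζ x y).trans (Real.sqrt_le_iff.2 ⟨sum_nonneg fun _ _ => abs_nonneg _, ?_⟩)
  simpa only [sq_abs] using
    sum_sq_le_sq_sum_of_nonneg (s := Finset.univ) (f := fun i => |x i - y i|) fun _ _ => abs_nonneg _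

theorem LipschitzEuclid.continuous {ι : Type*} [Fintype ι] {ζ : (ι → ℝ) → ℝ}
    (hζ : LipschitzEuclid ζ) : Continuous ζ := by
  refine continuous_iff_continuousAt.2 fun x => tendsto_iff_dist_tendsto_zero.2 ?_
  have hlim : Filter.Tendsto (fun y : ι → ℝ => Real.sqrt (∑ i, (y i - x i) ^ 2))
      (nhds x) (nhds 0) := by
    have hc : Continuous fun y : ι → ℝ => Real.sqrt (∑ i, (y i - x i) ^ 2) := by fun_prop
    simpa using hc.tendsto x
  exact squeeze_zero (fun _ => dist_nonneg) (fun y => hζ y x) hlim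

section Wasserstein

variable {Ω : Type*} [MeasurableSpace Ω] {μ : Measure Ω}
  {ι : Type*} [Fintype ι] {X Z : Ω → ι → ℝ} {ζ : (ι → ℝ) → ℝ}

theorem LipschitzEuclid.integrable_sub (hζ : LipschitzEuclid ζ) (hX : Measurable X)
    (hXi : ∀ i, Integrable (fun ω => X ω i) μ) :
    Integrable (fun ω => ζ (X ω) - ζ 0) μ := by
  refine (integrable_finsetSum Finset.univ fun i _ => (hXi i).abs).mono' ?_
    (ae_of_all _ fun ω => by simpa using hζ.abs_sub_le_sum (X ω) 0)
  exact ((hζ.continuous.measurable.comp hX).sub_const _).aestronglyMeasurable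

theorem LipschitzEuclid.abs_integral_sub_le [IsProbabilityMeasure μ]
    (hζ : LipschitzEuclid ζ) (hX : Measurable X)
    (hXi : ∀ i, Integrable (fun ω => X ω i) μ) :
    |∫ ω, ζ (X ω) ∂μ - ζ 0| ≤ ∫ ω, ∑ i, |X ω i| ∂μ := by
  have hint : Integrable (fun ω => ζ (X ω)) μ :=
    ((hζ.integrable_sub hX hXi).add (integrable_const (ζ 0))).congr (ae_of_all _ fun ω => by simp)
  have heq : ∫ ω, ζ (X ω) ∂μ - ζ 0 = ∫ ω, (ζ (X ω) - ζ 0) ∂μ := by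
    rw [integral_sub hint (integrable_const _)]
    simp
  rw [heq, ← Real.norm_eq_abs]
  exact norm_integral_le_of_norm_le (integrable_finsetSum Finset.univ fun i _ => (hXi i).abs)
    (ae_of_all _ fun ω => by simpa using hζ.abs_sub_le_sum (X ω) 0)

theorem LipschitzEuclid.abs_integral_sub_integral_le_d1 [IsProbabilityMeasure μ]
    (hζ : LipschitzEuclid ζ)
    (hX : Measurable X) (hZ : Measurable Z) (hXi : ∀ i, Integrable (fun ω => X ω i) μ)
    (hZi : ∀ i, Integrable (fun ω => Z ω i) μ) :
    |∫ ω, ζ (X ω) ∂μ - ∫ ω, ζ (Z ω) ∂μ| ≤ d1 μ X Z := by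
  refine le_csSup ⟨∫ ω, ∑ i, |X ω i| ∂μ + ∫ ω, ∑ i, |Z ω i| ∂μ, ?_⟩ ⟨ζ, hζ, rfl⟩
  rintro _ ⟨ξ, hξ, rfl⟩
  refine (abs_sub_le _ (ξ 0) _).trans (add_le_add (hξ.abs_integral_sub_le hX hXi) ?_)
  rw [abs_sub_comm]
  exact hξ.abs_integral_sub_le hZ hZi

end Wasserstein

/-- **Truncation step in the moment-product comparison.** For every truncation level `T > 0`,
`|E ∏ Xᵢ − E ∏ Zᵢ| ≤ √d · T^{d−1} · d₁(X,Z) + T^{−q} · 4d · C_q`. -/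
theorem stmt6 {Ω : Type*} [MeasurableSpace Ω] (μ : Measure Ω) [IsProbabilityMeasure μ]
    (d : ℕ) (q Cq : ℝ) (hq : 0 < q) (X Z : Ω → Fin d → ℝ)
    (hX : Measurable X) (hZ : Measurable Z)
    (hXi : ∀ i, Integrable (fun ω => |X ω i| ^ (q + d)) μ)
    (hZi : ∀ i, Integrable (fun ω => |Z ω i| ^ (q + d)) μ)
    (hXm : ∀ i, (∫ ω, |X ω i| ^ (q + d) ∂μ) < Cq)
    (hZm : ∀ i, (∫ ω, |Z ω i| ^ (q + d) ∂μ) < Cq)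
    (T : ℝ) (hT : 0 < T) :
    |(∫ ω, ∏ i, X ω i ∂μ) - ∫ ω, ∏ i, Z ω i ∂μ| ≤
      Real.sqrt d * T ^ ((d : ℝ) - 1) * d1 μ X Z + T ^ (-q) * (4 * d * Cq) := by
  have hclip : |∫ ω, ∏ i, clip T (X ω i) ∂μ - ∫ ω, ∏ i, clip T (Z ω i) ∂μ| ≤
      Real.sqrt d * T ^ ((d : ℝ) - 1) * d1 μ X Z := by
    rcases d.eq_zero_or_pos with rfl | hd
    · simp
    set L := Real.sqrt d * T ^ ((d : ℝ) - 1) with hL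
    have hLpos : 0 < L := by positivity
    have hζ : LipschitzEuclid fun x : Fin d → ℝ => L⁻¹ * ∏ i, clip T (x i) := fun x y => by
      rw [← mul_sub, abs_mul, abs_of_pos (inv_pos.2 hLpos), inv_mul_le_iff₀ hLpos]
      exact abs_prod_clip_sub_prod_clip_le hT x y
    have h := hζ.abs_integral_sub_integral_le_d1 hX hZ
      (integrable_coord_of_moments hq.le hX hXi) (integrable_coord_of_moments hq.le hZ hZi)
    rwa [integral_const_mul, integral_const_mul, ← mul_sub, abs_mul,
      abs_of_pos (inv_pos.2 hLpos), inv_mul_le_iff₀ hLpos] at h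
  have hXc := abs_integral_prod_sub_integral_prod_clip_le hq.le hT hX hXi fun i => (hXm i).le
  have hZc := abs_integral_prod_sub_integral_prod_clip_le hq.le hT hZ hZi fun i => (hZm i).le
  rw [abs_le] at *
  constructor <;> linarith

end
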